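/- arXiv:2503.15186 — 3 statements merged into one kernel-verified Lean document; each statement's English description precedes it below -/
import Mathlib

section
/- Let Σ ∈ ℝ^{n×n} be symmetric and let V ∈ ℝ^{n×n} be orthogonal. Then 0 ≤ τ(Diag(Vᵀ Σ V)²) ≤ τ(Σ²); equivalently, writing Var(a) = (1/n)Σ_i a_i² − ((1/n)Σ_i a_i)² for a ∈ ℝⁿ, the empirical variance of the oracle eigenvalues λ^O_i = (Vᵀ Σ V)_{ii} satisfies 0 ≤ Var(λ^O) ≤ Var(λ^true), where λ^true is the vector of eigenvalues of Σ (the oracle procedure preserves the mean of the eigenvalue distribution and shrinks its variance). -/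
open Matrix

/-- The normalized trace `τ(A) = Tr(A) / n`. -/
noncomputable def normTrace {n : ℕ} (A : Matrix (Fin n) (Fin n) ℝ) : ℝ :=
  (n : ℝ)⁻¹ * A.trace

/-- `Diag(A)`: the matrix with the same diagonal as `A` and zero off-diagonal entries. -/
def diagPart {n : ℕ} (A : Matrix (Fin n) (Fin n) ℝ) : Matrix (Fin n) (Fin n) ℝ :=
  Matrix.diagonal (fun i => A i i)

/-- The empirical mean `Mean(a) = (1/n) ∑ i, a i` of a vector. -/
noncomputable def vecMean {n : ℕ} (a : Fin n → ℝ) : ℝ :=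
  (n : ℝ)⁻¹ * ∑ i, a i

/-- The empirical variance `Var(a) = (1/n) ∑ i, a i ² − Mean(a)²` of a vector. -/
noncomputable def vecVar {n : ℕ} (a : Fin n → ℝ) : ℝ :=
  (n : ℝ)⁻¹ * (∑ i, (a i) ^ 2) - (vecMean a) ^ 2

theorem trace_conj_aux {n : ℕ} (S V : Matrix (Fin n) (Fin n) ℝ) (hV : Vᵀ * V = 1) :
    (Vᵀ * S * V).trace = S.trace := by
  have hV' : V * Vᵀ = 1 := mul_eq_one_comm.mp hV
  rw [Matrix.mul_assoc, Matrix.trace_mul_comm, Matrix.mul_assoc, hV', Matrix.mul_one]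

theorem conj_sq_aux {n : ℕ} (S V : Matrix (Fin n) (Fin n) ℝ) (hV : Vᵀ * V = 1) :
    (Vᵀ * S * V) * (Vᵀ * S * V) = Vᵀ * (S * S) * V := by
  have hV' : V * Vᵀ = 1 := mul_eq_one_comm.mp hV
  calc (Vᵀ * S * V) * (Vᵀ * S * V) = Vᵀ * S * (V * Vᵀ) * S * V := by
        simp only [Matrix.mul_assoc]
    _ = Vᵀ * (S * S) * V := by rw [hV', Matrix.mul_one]; simp only [Matrix.mul_assoc]

theorem diag_sq_le_aux {n : ℕ} (M : Matrix (Fin n) (Fin n) ℝ) (hM : Mᵀ = M) :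
    ∑ i, (M i i) ^ 2 ≤ (M * M).trace := by
  simp only [Matrix.trace, Matrix.diag, Matrix.mul_apply]
  refine Finset.sum_le_sum fun i _ => ?_
  have h : ∀ j, M i j * M j i = (M i j) ^ 2 := fun j => by
    have : M j i = M i j := congrFun (congrFun hM i) j
    rw [this, sq]
  simp only [h]
  exact Finset.single_le_sum (f := fun j => (M i j) ^ 2) (fun j _ => sq_nonneg _)
    (Finset.mem_univ i)

theorem eig_sq_aux {n : ℕ} (S : Matrix (Fin n) (Fin n) ℝ) (hS : S.IsHermitian) :
    ∑ i, (hS.eigenvalues i) ^ 2 = (S * S).trace := by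
  have hU : (hS.eigenvectorUnitary : Matrix (Fin n) (Fin n) ℝ)ᵀ *
      (hS.eigenvectorUnitary : Matrix (Fin n) (Fin n) ℝ) = 1 := by
    have := Unitary.coe_star_mul_self hS.eigenvectorUnitary
    rwa [Matrix.star_eq_conjTranspose, Matrix.conjTranspose_eq_transpose_of_trivial] at this
  have hD := hS.conjStarAlgAut_star_eigenvectorUnitary
  rw [Unitary.conjStarAlgAut_apply] at hD
  simp only [Unitary.coe_star, Matrix.transpose_transpose, Matrix.star_eq_conjTranspose,
    Matrix.conjTranspose_eq_transpose_of_trivial] at hD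
  rw [← trace_conj_aux (S * S) _ hU, ← conj_sq_aux S _ hU, hD, Matrix.diagonal_mul_diagonal,
    Matrix.trace_diagonal]
  simp [sq]

/-- For `Σ` symmetric and `V` orthogonal, `0 ≤ τ(Diag(Vᵀ Σ V)²) ≤ τ(Σ²)`; equivalently,
the empirical variance of the oracle eigenvalues `λ^O_i = (Vᵀ Σ V)_{ii}` satisfies
`0 ≤ Var(λ^O) ≤ Var(λ^true)`, where `λ^true` are the eigenvalues of `Σ`:
the oracle procedure shrinks the variance of the eigenvalue distribution. -/
theorem oracle_eigenvalues_shrink_variance {n : ℕ}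
    (S : Matrix (Fin n) (Fin n) ℝ) (hS : S.IsHermitian)
    (V : Matrix (Fin n) (Fin n) ℝ) (hV : Vᵀ * V = 1) :
    (0 ≤ normTrace (diagPart (Vᵀ * S * V) * diagPart (Vᵀ * S * V)) ∧
      normTrace (diagPart (Vᵀ * S * V) * diagPart (Vᵀ * S * V)) ≤ normTrace (S * S)) ∧
    (0 ≤ vecVar (fun i => (Vᵀ * S * V) i i) ∧
      vecVar (fun i => (Vᵀ * S * V) i i) ≤ vecVar hS.eigenvalues) := by
  have hn : (0 : ℝ) ≤ (n : ℝ)⁻¹ := by positivity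
  have hST : Sᵀ = S := by
    have := hS.eq
    rwa [Matrix.conjTranspose_eq_transpose_of_trivial] at this
  have hM : (Vᵀ * S * V)ᵀ = Vᵀ * S * V := by
    simp [Matrix.transpose_mul, hST, Matrix.mul_assoc]
  have hle := diag_sq_le_aux _ hM
  rw [conj_sq_aux S V hV, trace_conj_aux _ V hV] at hle
  have htr : ∑ i, (Vᵀ * S * V) i i = ∑ i, hS.eigenvalues i := by
    have h1 := trace_conj_aux S V hV
    have h2 := hS.trace_eq_sum_eigenvalues
    simp only [RCLike.ofReal_real_eq_id, id] at h2
    rw [← h2, ← h1]; rfl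
  have hd : normTrace (diagPart (Vᵀ * S * V) * diagPart (Vᵀ * S * V))
      = (n : ℝ)⁻¹ * ∑ i, ((Vᵀ * S * V) i i) ^ 2 := by
    unfold normTrace diagPart
    rw [Matrix.diagonal_mul_diagonal, Matrix.trace_diagonal]
    simp only [sq]
  refine ⟨⟨?_, ?_⟩, ?_, ?_⟩
  · rw [hd]
    exact mul_nonneg hn (Finset.sum_nonneg fun i _ => sq_nonneg _)
  · rw [hd]
    exact mul_le_mul_of_nonneg_left hle hn
  · unfold vecVar vecMean
    have hc := sq_sum_le_card_mul_sum_sq (s := Finset.univ) (f := fun i => (Vᵀ * S * V) i i)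
    simp only [Finset.card_univ, Fintype.card_fin] at hc
    rcases Nat.eq_zero_or_pos n with h0 | h0
    · subst h0; simp
    · have hn0 : (n : ℝ) ≠ 0 := by positivity
      have := mul_le_mul_of_nonneg_left hc (sq_nonneg ((n : ℝ)⁻¹))
      rw [sub_nonneg, mul_pow]
      refine this.trans (le_of_eq ?_)
      field_simp
  · unfold vecVar vecMean
    rw [htr, eig_sq_aux S hS]
    exact sub_le_sub_right (mul_le_mul_of_nonneg_left hle hn) _
end

section
/- (Square-root scaling of the optimal split.) Fix real numbers p, q > 0 and for each n > 0 set k_opt(n) = p·(2q + p(2 + 2p + q) + √(p²q² + 2n(p + q)(p + p² + q))) / (2(p + q)(p + p² + q)). Then k_opt(n)/√n converges, as n → ∞, to p / √(2(p + q)(p + p² + q)); i.e. the optimal train–test split factor is asymptotically proportional to the square root of the matrix dimension. -/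
open Real Filter

/-- Square-root scaling of the optimal split: `k_opt(n)/√n` converges, as `n → ∞`, to
`p/√(2(p + q)(p + p² + q))`. -/
theorem optimal_split_sqrt_scaling (p q : ℝ) (hp : 0 < p) (hq : 0 < q) :
    Tendsto
      (fun n : ℝ =>
        (p * (2 * q + p * (2 + 2 * p + q) +
            Real.sqrt (p ^ 2 * q ^ 2 + 2 * n * (p + q) * (p + p ^ 2 + q))) /
          (2 * (p + q) * (p + p ^ 2 + q))) / Real.sqrt n)
      atTop
      (nhds (p / Real.sqrt (2 * (p + q) * (p + p ^ 2 + q)))) := by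
  have hD : 0 < 2 * (p + q) * (p + p ^ 2 + q) := by positivity
  set D := 2 * (p + q) * (p + p ^ 2 + q) with hDdef
  have h1 : Tendsto (fun n : ℝ => (2 * q + p * (2 + 2 * p + q)) / Real.sqrt n) atTop (nhds 0) :=
    Tendsto.div_atTop tendsto_const_nhds Real.tendsto_sqrt_atTop
  have h2 : Tendsto (fun n : ℝ => p ^ 2 * q ^ 2 / n) atTop (nhds 0) :=
    Tendsto.div_atTop tendsto_const_nhds tendsto_id
  have h3 : Tendsto (fun n : ℝ => Real.sqrt (p ^ 2 * q ^ 2 / n + D)) atTop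
      (nhds (Real.sqrt (0 + D))) :=
    (Real.continuous_sqrt.tendsto _).comp (h2.add tendsto_const_nhds)
  have h4 := ((h1.add h3).const_mul p).div_const D
  have h5 : p * (0 + Real.sqrt (0 + D)) / D = p / Real.sqrt D := by
    have hs : 0 < Real.sqrt D := Real.sqrt_pos.mpr hD
    rw [zero_add, zero_add, div_eq_div_iff hD.ne' hs.ne', mul_assoc, Real.mul_self_sqrt hD.le]
  rw [h5] at h4
  refine h4.congr' ?_
  filter_upwards [eventually_gt_atTop (0 : ℝ)] with n hn
  have hsn : 0 < Real.sqrt n := Real.sqrt_pos.mpr hn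
  have h6 : p ^ 2 * q ^ 2 / n + D = (p ^ 2 * q ^ 2 + 2 * n * (p + q) * (p + p ^ 2 + q)) / n := by
    rw [hDdef]
    field_simp
  rw [h6, Real.sqrt_div' _ hn.le, ← add_div]
  ring
end

section
/- (Convergence of the holdout error to the oracle error.) Fix real numbers p, q > 0 and for each n set t_n = n/q. Let (k_n) be a sequence of real numbers with k_n > 1 for all n, k_n → ∞ and k_n/n → 0 as n → ∞. Then the holdout error formula (2k_n/t_n − 1)·(p²/(p + k_n·q/(k_n − 1)) + 1) + 1 + p converges, as n → ∞, to pq/(p + q), which is the expected normalized Frobenius error of the oracle estimator for a white inverse Wishart population with parameter p and aspect ratio q in the high-dimensional limit. -/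
open Real Filter

/-- Convergence of the holdout error to the oracle error: for `t_n = n/q` and any
sequence of splits `k_n > 1` with `k_n → ∞` and `k_n/n → 0`, the holdout error formula
`(2k_n/t_n − 1)(p²/(p + k_n q/(k_n − 1)) + 1) + 1 + p` converges to the oracle error
`pq/(p + q)`. -/
theorem holdout_error_tendsto_oracle (p q : ℝ) (hp : 0 < p) (hq : 0 < q)
    (k : ℕ → ℝ) (hk1 : ∀ n, 1 < k n)
    (hktop : Tendsto k atTop atTop)
    (hkn : Tendsto (fun n : ℕ => k n / (n : ℝ)) atTop (nhds 0)) :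
    Tendsto
      (fun n : ℕ =>
        (2 * k n / ((n : ℝ) / q) - 1) * (p ^ 2 / (p + k n * q / (k n - 1)) + 1) + 1 + p)
      atTop
      (nhds (p * q / (p + q))) := by
  have h1 : Tendsto (fun n : ℕ => 2 * k n / ((n : ℝ) / q)) atTop (nhds 0) := by
    have h := hkn.const_mul (2 * q)
    rw [mul_zero] at h
    refine h.congr fun n => ?_
    rw [div_div_eq_mul_div]
    ring
  have h2 : Tendsto (fun n : ℕ => k n * q / (k n - 1)) atTop (nhds q) := by
    have h3 : Tendsto (fun n : ℕ => k n - 1) atTop atTop :=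
      tendsto_atTop_add_const_right _ (-1) hktop
    have h := (h3.const_div_atTop q).const_add q
    rw [add_zero] at h
    refine h.congr fun n => ?_
    have hn : k n - 1 ≠ 0 := (sub_pos.mpr (hk1 n)).ne'
    field_simp
    ring
  have hpq : p + q ≠ 0 := (add_pos hp hq).ne'
  have h4 : Tendsto (fun n : ℕ => p ^ 2 / (p + k n * q / (k n - 1))) atTop
      (nhds (p ^ 2 / (p + q))) :=
    tendsto_const_nhds.div (h2.const_add p) hpq
  have h5 := (((h1.sub_const 1).mul (h4.add_const 1)).add_const 1).add_const p
  have e : (0 - 1) * (p ^ 2 / (p + q) + 1) + 1 + p = p * q / (p + q) := by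
    field_simp
    ring
  rw [e] at h5
  exact h5
end
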